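/- Let [a, b] ⊂ (R₀, ∞) be an interval on which γ(r) > 0 and m(r)/r ≥ 3/8 for all r ∈ [a, b], and define x(r) = m(r)/(r·γ(r)). Then r·x'(r) ≥ (4/3)·x(r)² − x(r) for all r ∈ [a, b]. -/

import Mathlib

open Real MeasureTheory

noncomputable section

/-- `γ(r) = -μ(r) - (1/2)·log(1 + L₀/r²)`. -/
def gam (L₀ : ℝ) (μ : ℝ → ℝ) (r : ℝ) : ℝ :=
  -μ r - (1 / 2) * Real.log (1 + L₀ / r ^ 2)

/-- Energy density `ρ(r) = C₁·max(γ(r),0)^q / r⁴`. -/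
def rho (L₀ C₁ q : ℝ) (μ : ℝ → ℝ) (r : ℝ) : ℝ :=
  C₁ * (max (gam L₀ μ r) 0) ^ q / r ^ 4

/-- Radial pressure `p(r) = C₂·max(γ(r),0)^(q+1) / r⁴`. -/
def pres (L₀ C₂ q : ℝ) (μ : ℝ → ℝ) (r : ℝ) : ℝ :=
  C₂ * (max (gam L₀ μ r) 0) ^ (q + 1) / r ^ 4

/-- `z(r) = C₃·max(γ(r),0)^q / r²`. -/
def zfun (L₀ C₃ q : ℝ) (μ : ℝ → ℝ) (r : ℝ) : ℝ :=
  C₃ * (max (gam L₀ μ r) 0) ^ q / r ^ 2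

/-- Quasi-local mass `m(r) = ∫_{R₀}^r 4π η² ρ(η) dη`. -/
def mass (R₀ L₀ C₁ q : ℝ) (μ : ℝ → ℝ) (r : ℝ) : ℝ :=
  ∫ η in R₀..r, 4 * π * η ^ 2 * rho L₀ C₁ q μ η

/-- `μ'(r) = (m/r² + 4πrp)·e^{2λ}` with `e^{-2λ} = 1 - 2m/r`. -/
def muder (R₀ L₀ C₁ C₂ q : ℝ) (μ : ℝ → ℝ) (r : ℝ) : ℝ :=
  (mass R₀ L₀ C₁ q μ r / r ^ 2 + 4 * π * r * pres L₀ C₂ q μ r) *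
    (1 - 2 * mass R₀ L₀ C₁ q μ r / r)⁻¹

/-- `γ'(r) = -μ'(r) + L₀/(r(r²+L₀))`. -/
def gamder (R₀ L₀ C₁ C₂ q : ℝ) (μ : ℝ → ℝ) (r : ℝ) : ℝ :=
  -muder R₀ L₀ C₁ C₂ q μ r + L₀ / (r * (r ^ 2 + L₀))

/-- A reduced static shell: `γ(R₀)=0`, `2m(r)/r<1` for `r ≥ R₀`, and the
field equation `μ'(r) = (m/r² + 4πrp)·(1-2m/r)⁻¹` for `r ≥ R₀`. -/
structure IsReducedShell (R₀ L₀ C₁ C₂ q : ℝ) (μ : ℝ → ℝ) : Prop where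
  inner_zero : gam L₀ μ R₀ = 0
  mass_lt : ∀ r, R₀ ≤ r → 2 * mass R₀ L₀ C₁ q μ r / r < 1
  field_eq : ∀ r, R₀ ≤ r → HasDerivAt μ (muder R₀ L₀ C₁ C₂ q μ r) r

theorem gam_hasDerivAt (R₀ L₀ C₁ C₂ q : ℝ) (μ : ℝ → ℝ)
    (hR₀ : 0 < R₀) (hL₀ : 0 < L₀)
    (hshell : IsReducedShell R₀ L₀ C₁ C₂ q μ) (r : ℝ) (hr : R₀ ≤ r) :
    HasDerivAt (gam L₀ μ) (gamder R₀ L₀ C₁ C₂ q μ r) r := by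
  have hr0 : 0 < r := lt_of_lt_of_le hR₀ hr
  have h1 : HasDerivAt (fun s : ℝ => 1 + L₀ / s ^ 2)
      ((0 * r ^ 2 - L₀ * (2 * r)) / (r ^ 2) ^ 2) r := by
    have h := ((hasDerivAt_const r L₀).div ((hasDerivAt_id r).pow 2) (by simp; positivity)).const_add 1
    exact h.congr_deriv (by simp)
  have h2 := h1.log (by positivity)
  have h3 := (hshell.field_eq r hr).neg.sub (h2.const_mul (1 / 2))
  refine h3.congr_deriv ?_
  unfold gamder
  field_simp
  ring

theorem mass_hasDerivAt (R₀ L₀ C₁ C₂ q : ℝ) (μ : ℝ → ℝ)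
    (hR₀ : 0 < R₀) (hL₀ : 0 < L₀) (hq : 2 ≤ q)
    (hshell : IsReducedShell R₀ L₀ C₁ C₂ q μ) (r : ℝ) (hr : R₀ < r) :
    HasDerivAt (mass R₀ L₀ C₁ q μ) (4 * π * r ^ 2 * rho L₀ C₁ q μ r) r := by
  have hc : ∀ s, R₀ ≤ s → ContinuousAt (fun η => 4 * π * η ^ 2 * rho L₀ C₁ q μ η) s := by
    intro s hs
    have hs0 : 0 < s := lt_of_lt_of_le hR₀ hs
    have hg := (gam_hasDerivAt R₀ L₀ C₁ C₂ q μ hR₀ hL₀ hshell s hs).continuousAt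
    unfold rho
    have h1 : ContinuousAt (fun η => (max (gam L₀ μ η) 0) ^ q) s :=
      (hg.max continuousAt_const).rpow_const (Or.inr (by linarith))
    have h2 : ContinuousAt (fun η : ℝ => 4 * π * η ^ 2) s := by fun_prop
    have h3 : ContinuousAt (fun η : ℝ => η ^ 4) s := by fun_prop
    exact h2.mul ((continuousAt_const.mul h1).div h3 (by positivity))
  refine intervalIntegral.integral_hasDerivAt_right ?_ ?_ (hc r hr.le)
  · apply ContinuousOn.intervalIntegrable
    intro s hs
    rw [Set.uIcc_of_le hr.le] at hs
    exact (hc s hs.1).continuousWithinAt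
  · exact ContinuousOn.stronglyMeasurableAtFilter isOpen_Ioi
      (fun s (hs : s ∈ Set.Ioi R₀) => (hc s (le_of_lt hs)).continuousWithinAt) r hr

/-- the Makino-type differential inequality (45) in the
proof of Theorem 1 of the paper. On an interval `[a,b] ⊂ (R₀,∞)` where
`γ > 0` and `m/r ≥ 3/8`, the function `x = m/(rγ)` is differentiable and
satisfies `r·x'(r) ≥ (4/3)x(r)² - x(r)`. -/
theorem makino_inequality (R₀ L₀ C₁ C₂ q a b : ℝ) (μ : ℝ → ℝ)
    (hR₀ : 0 < R₀) (hL₀ : 0 < L₀) (hC₁ : 0 < C₁) (hC₂ : 0 < C₂) (hq : 2 ≤ q)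
    (hshell : IsReducedShell R₀ L₀ C₁ C₂ q μ)
    (ha : R₀ < a) (hab : a ≤ b)
    (hγpos : ∀ r ∈ Set.Icc a b, 0 < gam L₀ μ r)
    (hm38 : ∀ r ∈ Set.Icc a b, 3 / 8 ≤ mass R₀ L₀ C₁ q μ r / r) :
    ∀ r ∈ Set.Icc a b,
      ∃ d : ℝ,
        HasDerivAt (fun s => mass R₀ L₀ C₁ q μ s / (s * gam L₀ μ s)) d r ∧
        (4 / 3) * (mass R₀ L₀ C₁ q μ r / (r * gam L₀ μ r)) ^ 2
            - mass R₀ L₀ C₁ q μ r / (r * gam L₀ μ r) ≤ r * d := by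
  intro r hr
  have hRr : R₀ < r := lt_of_lt_of_le ha hr.1
  have hr0 : 0 < r := hR₀.trans hRr
  have hg := gam_hasDerivAt R₀ L₀ C₁ C₂ q μ hR₀ hL₀ hshell r hRr.le
  have hm := mass_hasDerivAt R₀ L₀ C₁ C₂ q μ hR₀ hL₀ hq hshell r hRr
  have hgp := hγpos r hr
  have hu := hm38 r hr
  have hlt := hshell.mass_lt r hRr.le
  have hd := hm.div ((hasDerivAt_id r).mul hg) (by simp; exact ⟨hr0.ne', hgp.ne'⟩)
  refine ⟨_, hd, ?_⟩
  have hrho : 0 ≤ rho L₀ C₁ q μ r := by unfold rho; positivity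
  have hp : 0 ≤ pres L₀ C₂ q μ r := by unfold pres; positivity
  have hM : 0 ≤ 4 * π * r ^ 2 * rho L₀ C₁ q μ r := by positivity
  have hP : 0 ≤ 4 * π * r * pres L₀ C₂ q μ r := by positivity
  have hG : r * gamder R₀ L₀ C₁ C₂ q μ r ≤ -(4 / 3) * (mass R₀ L₀ C₁ q μ r / r) := by
    unfold gamder muder
    generalize 4 * π * r * pres L₀ C₂ q μ r = P at *
    obtain ⟨u, hu'⟩ : ∃ u, u = mass R₀ L₀ C₁ q μ r / r := ⟨_, rfl⟩
    have hmu : mass R₀ L₀ C₁ q μ r = u * r := by rw [hu']; field_simp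
    rw [← hu'] at hu ⊢
    rw [mul_div_assoc, ← hu'] at hlt
    rw [mul_div_assoc, ← hu', hmu]
    have hpos : 0 < 1 - 2 * u := by linarith
    have e1 : r * (L₀ / (r * (r ^ 2 + L₀))) ≤ 1 := by
      rw [← mul_div_assoc, div_le_one (by positivity)]
      have : 0 < r * r ^ 2 := by positivity
      nlinarith
    have e2 : 0 ≤ r * (P * (1 - 2 * u)⁻¹) := by positivity
    have e3 : 1 + 4 / 3 * u ≤ u * (1 - 2 * u)⁻¹ := by
      rw [← div_eq_mul_inv, le_div_iff₀ hpos]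
      nlinarith
    have e4 : r * (-((u * r / r ^ 2 + P) * (1 - 2 * u)⁻¹) + L₀ / (r * (r ^ 2 + L₀)))
        = -(u * (1 - 2 * u)⁻¹) - r * (P * (1 - 2 * u)⁻¹) + r * (L₀ / (r * (r ^ 2 + L₀))) := by
      have : u * r / r ^ 2 = u / r := by field_simp
      rw [this]
      have : u = r * (u / r) := by field_simp
      generalize (1 - 2 * u)⁻¹ = k
      generalize u / r = w at *
      rw [this]; ring
    rw [e4]; linarith
  have hmpos : 0 < mass R₀ L₀ C₁ q μ r := by
    have : 0 < mass R₀ L₀ C₁ q μ r / r := by linarith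
    exact (div_pos_iff_of_pos_right hr0).1 this
  simp only [Pi.mul_apply, id]
  generalize 4 * π * r ^ 2 * rho L₀ C₁ q μ r = M at *
  generalize gamder R₀ L₀ C₁ C₂ q μ r = D at *
  generalize gam L₀ μ r = g at *
  generalize mass R₀ L₀ C₁ q μ r = m at *
  have e : r * ((M * (r * g) - m * (1 * g + r * D)) / (r * g) ^ 2)
      - ((4 / 3) * (m / (r * g)) ^ 2 - m / (r * g))
      = M / g + m / (r * g ^ 2) * (-(4 / 3) * (m / r) - r * D) := by
    field_simp
    ring
  have h1 : 0 ≤ M / g := by positivity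
  have h2 : 0 ≤ m / (r * g ^ 2) * (-(4 / 3) * (m / r) - r * D) :=
    mul_nonneg (by positivity) (by linarith)
  linarith

end
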